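/- arXiv:1206.4547 — 3 statements merged into one kernel-verified Lean document; each statement's English description precedes it below -/
import Mathlib

section
/- Capture-avoiding simultaneous substitution for PCF satisfies the monad laws: for all PCF-typed contexts V, W, Z, all substitutions f : ∀ t, V t → PCF W t and g : ∀ t, W t → PCF Z t, all PCF types t and all x : V t, M : PCF V t, one has (1) bind f t (Var x) = f t x, (2) bind Var t M = M, and (3) bind g t (bind f t M) = bind (fun t x => bind g t (f t x)) t M. -/
/-- PCF types: `Nat`, `Bool` and a binary arrow. -/
inductive PTy : Type
  | nat : PTy
  | bool : PTy
  | arrow : PTy → PTy → PTy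

/-- The context `V` extended by one fresh variable of type `s`. -/
def ext (V : PTy → Type) (s : PTy) : PTy → Type :=
  fun t => Sum (V t) (PLift (s = t))

/-- PCF terms over a typed context. -/
inductive PCF : (PTy → Type) → PTy → Type 1
  | Var : ∀ {V : PTy → Type} (t : PTy), V t → PCF V t
  | Abs : ∀ {V : PTy → Type} (s t : PTy), PCF (ext V s) t → PCF V (PTy.arrow s t)
  | App : ∀ {V : PTy → Type} (s t : PTy), PCF V (PTy.arrow s t) → PCF V s → PCF V t
  | Fix : ∀ {V : PTy → Type} (s : PTy), PCF V (PTy.arrow s s) → PCF V s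
  | Num : ∀ {V : PTy → Type}, ℕ → PCF V PTy.nat
  | Succ : ∀ {V : PTy → Type}, PCF V (PTy.arrow PTy.nat PTy.nat)
  | Pred : ∀ {V : PTy → Type}, PCF V (PTy.arrow PTy.nat PTy.nat)
  | IsZero : ∀ {V : PTy → Type}, PCF V (PTy.arrow PTy.nat PTy.bool)
  | True : ∀ {V : PTy → Type}, PCF V PTy.bool
  | False : ∀ {V : PTy → Type}, PCF V PTy.bool
  | CondNat : ∀ {V : PTy → Type},
      PCF V (PTy.arrow PTy.bool (PTy.arrow PTy.nat (PTy.arrow PTy.nat PTy.nat)))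
  | CondBool : ∀ {V : PTy → Type},
      PCF V (PTy.arrow PTy.bool (PTy.arrow PTy.bool (PTy.arrow PTy.bool PTy.bool)))

/-- Action of a context morphism on an extended context. -/
def extMap {V W : PTy → Type} (f : ∀ t, V t → W t) (s : PTy) :
    ∀ t, ext V s t → ext W s t := fun t x =>
  match x with
  | .inl v => .inl (f t v)
  | .inr h => .inr h

/-- Renaming (functoriality in the context). -/
def rename : ∀ {V W : PTy → Type}, (∀ t, V t → W t) → ∀ t, PCF V t → PCF W t
  | _, _, f, _, .Var t x => .Var t (f t x)
  | _, _, f, _, .Abs s t M => .Abs s t (rename (extMap f s) t M)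
  | _, _, f, _, .App s t M N => .App s t (rename f _ M) (rename f s N)
  | _, _, f, _, .Fix s M => .Fix s (rename f _ M)
  | _, _, _, _, .Num n => .Num n
  | _, _, _, _, .Succ => .Succ
  | _, _, _, _, .Pred => .Pred
  | _, _, _, _, .IsZero => .IsZero
  | _, _, _, _, .True => .True
  | _, _, _, _, .False => .False
  | _, _, _, _, .CondNat => .CondNat
  | _, _, _, _, .CondBool => .CondBool

/-- Lifting of a substitution under a binder of type `s`. -/
def lift {V W : PTy → Type} (f : ∀ t, V t → PCF W t) (s : PTy) :
    ∀ t, ext V s t → PCF (ext W s) t := fun t x =>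
  match x with
  | .inl v => rename (fun _ w => Sum.inl w) t (f t v)
  | .inr h => .Var t (Sum.inr h)

/-- Capture-avoiding simultaneous substitution for PCF. -/
def bind : ∀ {V W : PTy → Type}, (∀ t, V t → PCF W t) → ∀ t, PCF V t → PCF W t
  | _, _, f, _, .Var t x => f t x
  | _, _, f, _, .Abs s t M => .Abs s t (bind (lift f s) t M)
  | _, _, f, _, .App s t M N => .App s t (bind f _ M) (bind f s N)
  | _, _, f, _, .Fix s M => .Fix s (bind f _ M)
  | _, _, _, _, .Num n => .Num n
  | _, _, _, _, .Succ => .Succ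
  | _, _, _, _, .Pred => .Pred
  | _, _, _, _, .IsZero => .IsZero
  | _, _, _, _, .True => .True
  | _, _, _, _, .False => .False
  | _, _, _, _, .CondNat => .CondNat
  | _, _, _, _, .CondBool => .CondBool

/-- Substitution of a single (the fresh) variable: `M[∗ := N]`. -/
def subst1 {V : PTy → Type} {s t : PTy} (M : PCF (ext V s) t) (N : PCF V s) :
    PCF V t :=
  bind (fun u x =>
    match x with
    | .inl v => .Var u v
    | .inr h => h.down ▸ N) t M

/-- One-step reduction of PCF, with congruence closure. -/
inductive Red : ∀ {V : PTy → Type} {t : PTy}, PCF V t → PCF V t → Prop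
  | beta {V : PTy → Type} {s t : PTy} (M : PCF (ext V s) t) (N : PCF V s) :
      Red (.App s t (.Abs s t M) N) (subst1 M N)
  | fix {V : PTy → Type} {s : PTy} (M : PCF V (PTy.arrow s s)) :
      Red (.Fix s M) (.App s s M (.Fix s M))
  | predZero {V : PTy → Type} :
      Red (.App PTy.nat PTy.nat .Pred (.Num 0)) (.Num 0 : PCF V PTy.nat)
  | predSucc {V : PTy → Type} (n : ℕ) :
      Red (.App PTy.nat PTy.nat .Pred
            (.App PTy.nat PTy.nat .Succ (.Num n)))
          (.Num n : PCF V PTy.nat)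
  | iszeroZero {V : PTy → Type} :
      Red (.App PTy.nat PTy.bool .IsZero (.Num 0)) (.True : PCF V PTy.bool)
  | iszeroSucc {V : PTy → Type} (n : ℕ) :
      Red (.App PTy.nat PTy.bool .IsZero
            (.App PTy.nat PTy.nat .Succ (.Num n)))
          (.False : PCF V PTy.bool)
  | condNatTrue {V : PTy → Type} (M N : PCF V PTy.nat) :
      Red (.App PTy.nat PTy.nat
            (.App PTy.nat (PTy.arrow PTy.nat PTy.nat)
              (.App PTy.bool (PTy.arrow PTy.nat (PTy.arrow PTy.nat PTy.nat))
                .CondNat .True) M) N) M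
  | condNatFalse {V : PTy → Type} (M N : PCF V PTy.nat) :
      Red (.App PTy.nat PTy.nat
            (.App PTy.nat (PTy.arrow PTy.nat PTy.nat)
              (.App PTy.bool (PTy.arrow PTy.nat (PTy.arrow PTy.nat PTy.nat))
                .CondNat .False) M) N) N
  | condBoolTrue {V : PTy → Type} (M N : PCF V PTy.bool) :
      Red (.App PTy.bool PTy.bool
            (.App PTy.bool (PTy.arrow PTy.bool PTy.bool)
              (.App PTy.bool (PTy.arrow PTy.bool (PTy.arrow PTy.bool PTy.bool))
                .CondBool .True) M) N) M
  | condBoolFalse {V : PTy → Type} (M N : PCF V PTy.bool) :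
      Red (.App PTy.bool PTy.bool
            (.App PTy.bool (PTy.arrow PTy.bool PTy.bool)
              (.App PTy.bool (PTy.arrow PTy.bool (PTy.arrow PTy.bool PTy.bool))
                .CondBool .False) M) N) N
  | absCong {V : PTy → Type} {s t : PTy} {M M' : PCF (ext V s) t} :
      Red M M' → Red (.Abs s t M) (.Abs s t M')
  | appL {V : PTy → Type} {s t : PTy} {M M' : PCF V (PTy.arrow s t)} {N : PCF V s} :
      Red M M' → Red (.App s t M N) (.App s t M' N)
  | appR {V : PTy → Type} {s t : PTy} {M : PCF V (PTy.arrow s t)} {N N' : PCF V s} :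
      Red N N' → Red (.App s t M N) (.App s t M N')
  | fixCong {V : PTy → Type} {s : PTy} {M M' : PCF V (PTy.arrow s s)} :
      Red M M' → Red (.Fix s M) (.Fix s M')

/-- `⇒*`: the reflexive–transitive closure of one-step PCF reduction. -/
def RedStar {V : PTy → Type} {t : PTy} : PCF V t → PCF V t → Prop :=
  Relation.ReflTransGen Red

theorem rename_rename_aux {V : PTy → Type} {t : PTy} (M : PCF V t) :
    ∀ {W Z : PTy → Type} (g : ∀ t, V t → W t) (h : ∀ t, W t → Z t),
      rename h t (rename g t M) = rename (fun u x => h u (g u x)) t M := by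
  induction M with
  | Abs s t M ih =>
    intros
    simp only [rename, _root_.bind, ih]
    congr 2
    funext u x
    rcases x with v | h
    · rfl
    · rfl
  | _ => intros; simp_all only [rename, _root_.bind]

theorem bind_rename_aux {V : PTy → Type} {t : PTy} (M : PCF V t) :
    ∀ {W Z : PTy → Type} (g : ∀ t, V t → W t) (f : ∀ t, W t → PCF Z t),
      bind f t (rename g t M) = bind (fun u x => f u (g u x)) t M := by
  induction M with
  | Abs s t M ih =>
    intros
    simp only [rename, _root_.bind, ih]
    congr 2
    funext u x
    rcases x with v | h
    · rfl
    · rfl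
  | _ => intros; simp_all only [rename, _root_.bind]

theorem rename_bind_aux {V : PTy → Type} {t : PTy} (M : PCF V t) :
    ∀ {W Z : PTy → Type} (f : ∀ t, V t → PCF W t) (h : ∀ t, W t → Z t),
      rename h t (bind f t M) = bind (fun u x => rename h u (f u x)) t M := by
  induction M with
  | Abs s t M ih =>
    intros
    simp only [rename, _root_.bind, ih]
    congr 2
    funext u x
    rcases x with v | h
    · simp only [lift, rename_rename_aux]
      exact rename_rename_aux _ _ _
    · rfl
  | _ => intros; simp_all only [rename, _root_.bind]

theorem bind_bind_aux {V : PTy → Type} {t : PTy} (M : PCF V t) :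
    ∀ {W Z : PTy → Type} (f : ∀ t, V t → PCF W t) (g : ∀ t, W t → PCF Z t),
      bind g t (bind f t M) = bind (fun u x => bind g u (f u x)) t M := by
  induction M with
  | Abs s t M ih =>
    intros
    simp only [rename, _root_.bind, ih]
    congr 2
    funext u x
    rcases x with v | h
    · simp only [lift, rename_bind_aux]
      exact bind_rename_aux _ _ _
    · rfl
  | _ => intros; simp_all only [rename, _root_.bind]

theorem lift_var_aux (V : PTy → Type) (s : PTy) :
    lift (@PCF.Var V) s = @PCF.Var (ext V s) := by
  funext u x
  rcases x with v | h
  · simp only [lift, rename]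
    rfl
  · rfl

theorem bind_var_aux {V : PTy → Type} {t : PTy} (M : PCF V t) :
    bind (@PCF.Var V) t M = M := by
  induction M with
  | Abs s t M ih => simp only [_root_.bind, lift_var_aux, ih]
  | _ => simp_all only [_root_.bind]

theorem pcf_bind_monad_laws :
    (∀ (V W : PTy → Type) (f : ∀ t, V t → PCF W t) (t : PTy) (x : V t),
        bind f t (PCF.Var t x) = f t x) ∧
    (∀ (V : PTy → Type) (t : PTy) (M : PCF V t),
        bind (@PCF.Var V) t M = M) ∧
    (∀ (V W Z : PTy → Type) (f : ∀ t, V t → PCF W t) (g : ∀ t, W t → PCF Z t)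
        (t : PTy) (M : PCF V t),
        bind g t (bind f t M) = bind (fun t x => bind g t (f t x)) t M) := by
  exact ⟨fun V W f t x => by simp only [_root_.bind], fun V t M => bind_var_aux M,
    fun V W Z f g t M => bind_bind_aux M f g⟩
end

section
/- The reduction preorder of PCF is preserved by simultaneous substitution in both arguments: for all PCF-typed contexts V, W, substitutions f, g : ∀ t, V t → PCF W t, every PCF type t and terms M, M' : PCF V t, (1) if M ⇒* M' then bind f t M ⇒* bind f t M', and (2) if f t x ⇒* g t x for every t and every x : V t, then bind f t M ⇒* bind g t M. -/
theorem extMap_comp {U V W : PTy → Type} (f : ∀ t, U t → V t) (g : ∀ t, V t → W t) (s : PTy) :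
    (fun t x => extMap g s t (extMap f s t x)) = extMap (fun t x => g t (f t x)) s := by
  funext t x; cases x <;> rfl

theorem rename_rename {U : PTy → Type} {t : PTy} (M : PCF U t) :
    ∀ {V W : PTy → Type} (f : ∀ t, U t → V t) (g : ∀ t, V t → W t),
    rename g t (rename f t M) = rename (fun t x => g t (f t x)) t M := by
  induction M <;> intro V W f g <;> simp_all [rename, extMap_comp]

theorem lift_extMap {U V W : PTy → Type} (f : ∀ t, U t → V t) (g : ∀ t, V t → PCF W t) (s : PTy) :
    (fun t x => lift g s t (extMap f s t x)) = lift (fun t x => g t (f t x)) s := by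
  funext t x; cases x <;> rfl

theorem bind_rename {U : PTy → Type} {t : PTy} (M : PCF U t) :
    ∀ {V W : PTy → Type} (f : ∀ t, U t → V t) (g : ∀ t, V t → PCF W t),
    bind g t (rename f t M) = bind (fun t x => g t (f t x)) t M := by
  induction M <;> intro V W f g <;> simp_all [rename, _root_.bind, lift_extMap]

theorem extMap_lift {U V W : PTy → Type} (f : ∀ t, U t → PCF V t) (g : ∀ t, V t → W t) (s : PTy) :
    (fun t x => rename (extMap g s) t (lift f s t x)) = lift (fun t x => rename g t (f t x)) s := by
  funext t x; cases x
  · exact (rename_rename (f t _) (fun _ w => Sum.inl w) (extMap g s)).trans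
      (rename_rename (f t _) g (fun _ w => (Sum.inl w : ext W s _))).symm
  · rfl

theorem rename_bind {U : PTy → Type} {t : PTy} (M : PCF U t) :
    ∀ {V W : PTy → Type} (f : ∀ t, U t → PCF V t) (g : ∀ t, V t → W t),
    rename g t (bind f t M) = bind (fun t x => rename g t (f t x)) t M := by
  induction M <;> intro V W f g <;> simp_all [rename, _root_.bind, extMap_lift]

theorem lift_lift {U V W : PTy → Type} (f : ∀ t, U t → PCF V t) (g : ∀ t, V t → PCF W t) (s : PTy) :
    (fun t x => bind (lift g s) t (lift f s t x)) = lift (fun t x => bind g t (f t x)) s := by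
  funext t x; cases x
  · exact (bind_rename _ _ _).trans (rename_bind _ _ _).symm
  · rfl

theorem bind_bind {U : PTy → Type} {t : PTy} (M : PCF U t) :
    ∀ {V W : PTy → Type} (f : ∀ t, U t → PCF V t) (g : ∀ t, V t → PCF W t),
    bind g t (bind f t M) = bind (fun t x => bind g t (f t x)) t M := by
  induction M <;> intro V W f g <;> simp_all [_root_.bind, lift_lift]

theorem lift_Var {V W : PTy → Type} (f : ∀ t, V t → W t) (s : PTy) :
    lift (fun t x => PCF.Var t (f t x)) s = fun t x => PCF.Var t (extMap f s t x) := by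
  funext t x; cases x <;> rfl

theorem rename_eq_bind {V : PTy → Type} {t : PTy} (M : PCF V t) :
    ∀ {W : PTy → Type} (f : ∀ t, V t → W t),
    rename f t M = bind (fun t x => PCF.Var t (f t x)) t M := by
  induction M <;> intro W f <;> simp_all [rename, _root_.bind, lift_Var]

theorem extMap_id {V : PTy → Type} (s : PTy) :
    extMap (fun t (x : V t) => x) s = fun _ x => x := by
  funext t x; cases x <;> rfl

theorem rename_id {V : PTy → Type} {t : PTy} (M : PCF V t) :
    rename (fun _ x => x) t M = M := by
  induction M <;> simp_all [rename, extMap_id]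

theorem bind_Var {V : PTy → Type} {t : PTy} (M : PCF V t) :
    bind (fun t x => PCF.Var t x) t M = M := by
  rw [← rename_eq_bind M (fun _ x => x), rename_id]

theorem bind_subst1 {V W : PTy → Type} {s t : PTy} (M : PCF (ext V s) t) (N : PCF V s)
    (f : ∀ t, V t → PCF W t) :
    bind f t (subst1 M N) = subst1 (bind (lift f s) t M) (bind f s N) := by
  unfold subst1
  rw [bind_bind, bind_bind]
  congr 1
  funext u x
  rcases x with v | ⟨h⟩
  rotate_left
  · obtain ⟨h⟩ := h
    cases h
    show _root_.bind f s N = _root_.bind _ s (PCF.Var (V := ext W s) s (Sum.inr (PLift.up rfl)))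
    simp only [_root_.bind]
  · show _root_.bind f u (PCF.Var u v) = _root_.bind _ u (rename (fun _ w => Sum.inl w) u (f u v))
    refine Eq.trans ?_ (bind_rename (f u v) _ _).symm
    rw [_root_.bind]
    exact (bind_Var _).symm

theorem Red.bind {V : PTy → Type} {t : PTy} {M M' : PCF V t} (h : Red M M') :
    ∀ {W : PTy → Type} (f : ∀ t, V t → PCF W t), Red (bind f t M) (bind f t M') := by
  induction h with
  | beta M N => intro W f; rw [bind_subst1]; exact Red.beta _ _
  | absCong _ ih => intro W f; exact Red.absCong (ih _)
  | appL _ ih => intro W f; exact Red.appL (ih _)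
  | appR _ ih => intro W f; exact Red.appR (ih _)
  | fixCong _ ih => intro W f; exact Red.fixCong (ih _)
  | fix M => intro W f; exact Red.fix _
  | _ => intro W f; constructor

theorem RedStar.bind {V : PTy → Type} {t : PTy} {M M' : PCF V t} (h : RedStar M M')
    {W : PTy → Type} (f : ∀ t, V t → PCF W t) : RedStar (bind f t M) (bind f t M') :=
  Relation.ReflTransGen.lift (_root_.bind f t) (fun _ _ h => Red.bind h f) _ _ h

theorem RedStar.bind_right {V : PTy → Type} {t : PTy} (M : PCF V t) :
    ∀ {W : PTy → Type} (f g : ∀ t, V t → PCF W t) (_ : ∀ t x, RedStar (f t x) (g t x)),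
    RedStar (_root_.bind f t M) (_root_.bind g t M) := by
  induction M with
  | Var t x => intro W f g h; exact h t x
  | Abs s t M ih =>
    intro W f g h
    refine Relation.ReflTransGen.lift (PCF.Abs s t) (fun _ _ h => Red.absCong h) _ _ (ih _ _ ?_)
    intro u x
    rcases x with v | p
    · simp only [_root_.lift, rename_eq_bind]
      exact RedStar.bind (h u v) _
    · exact Relation.ReflTransGen.refl
  | App s t M N ihM ihN =>
    intro W f g h
    exact Relation.ReflTransGen.trans
      (Relation.ReflTransGen.lift (fun X => PCF.App s t X _) (fun _ _ h => Red.appL h) _ _ (ihM f g h))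
      (Relation.ReflTransGen.lift (fun X => PCF.App s t _ X) (fun _ _ h => Red.appR h) _ _ (ihN f g h))
  | Fix s M ih =>
    intro W f g h
    exact Relation.ReflTransGen.lift (PCF.Fix s) (fun _ _ h => Red.fixCong h) _ _ (ih f g h)
  | _ => intro W f g h; exact Relation.ReflTransGen.refl

theorem pcf_red_preserved_by_bind :
    (∀ (V W : PTy → Type) (f : ∀ t, V t → PCF W t) (t : PTy) (M M' : PCF V t),
        RedStar M M' → RedStar (bind f t M) (bind f t M')) ∧
    (∀ (V W : PTy → Type) (f g : ∀ t, V t → PCF W t)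
        (_ : ∀ (t : PTy) (x : V t), RedStar (f t x) (g t x))
        (t : PTy) (M : PCF V t),
        RedStar (bind f t M) (bind g t M)) := by
  exact ⟨fun V W f t M M' h => RedStar.bind h f,
    fun V W f g h t M => RedStar.bind_right M f g h⟩
end

section
/- There exists a translation from PCF to the untyped lambda calculus which is faithful with respect to reduction and compatible with substitution: there is a family of functions θ_{V,t} : PCF V t → ULC (Σ t, V t), indexed by PCF-typed contexts V and PCF types t, such that (1) θ (Var x) = Var ⟨t, x⟩ for every x : V t; (2) θ commutes with substitution: for every substitution f : ∀ t, V t → PCF W t and every M : PCF V t, θ (bind f t M) = bind (fun p => θ (f p.1 p.2)) (θ M); and (3) θ is faithful with respect to reductions: if M ⇒* N in PCF then θ M β* θ N in ULC. -/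
/-- Untyped lambda terms over a type `X` of variables. -/
inductive ULC : Type → Type 1
  | Var : ∀ {X : Type}, X → ULC X
  | Abs : ∀ {X : Type}, ULC (Option X) → ULC X
  | App : ∀ {X : Type}, ULC X → ULC X → ULC X

/-- Renaming for untyped lambda terms. -/
def urename : ∀ {X Y : Type}, (X → Y) → ULC X → ULC Y
  | _, _, f, .Var x => .Var (f x)
  | _, _, f, .Abs M => .Abs (urename (Option.map f) M)
  | _, _, f, .App M N => .App (urename f M) (urename f N)

/-- Lifting of a substitution under the binder of `Abs`. -/
def ulift' {X Y : Type} (f : X → ULC Y) : Option X → ULC (Option Y)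
  | none => .Var none
  | some x => urename some (f x)

/-- Capture-avoiding simultaneous substitution for the untyped lambda calculus. -/
def ubind : ∀ {X Y : Type}, (X → ULC Y) → ULC X → ULC Y
  | _, _, f, .Var x => f x
  | _, _, f, .Abs M => .Abs (ubind (ulift' f) M)
  | _, _, f, .App M N => .App (ubind f M) (ubind f N)

/-- Substitution of the bound variable: `M[∗ := N]`. -/
def usubst1 {X : Type} (M : ULC (Option X)) (N : ULC X) : ULC X :=
  ubind (fun x => match x with | none => N | some y => .Var y) M

/-- One-step beta reduction for the untyped lambda calculus. -/
inductive UBeta : ∀ {X : Type}, ULC X → ULC X → Prop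
  | beta {X : Type} (M : ULC (Option X)) (N : ULC X) :
      UBeta (.App (.Abs M) N) (usubst1 M N)
  | absCong {X : Type} {M M' : ULC (Option X)} :
      UBeta M M' → UBeta (.Abs M) (.Abs M')
  | appL {X : Type} {M M' N : ULC X} : UBeta M M' → UBeta (.App M N) (.App M' N)
  | appR {X : Type} {M N N' : ULC X} : UBeta N N' → UBeta (.App M N) (.App M N')

/-- `β*` for the untyped lambda calculus. -/
def UBetaStar {X : Type} : ULC X → ULC X → Prop :=
  Relation.ReflTransGen UBeta

namespace Trans

theorem urename_urename {X Y Z : Type} (f : X → Y) (g : Y → Z) (M : ULC X) :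
    urename g (urename f M) = urename (fun x => g (f x)) M := by
  induction M generalizing Y Z with
  | Var x => rfl
  | Abs M ih =>
    simp only [urename, ih]
    congr 2
    funext x
    cases x <;> rfl
  | App M N ihM ihN => simp only [urename, ihM, ihN]

theorem ubind_urename {X Y Z : Type} (f : X → Y) (g : Y → ULC Z) (M : ULC X) :
    ubind g (urename f M) = ubind (fun x => g (f x)) M := by
  induction M generalizing Y Z with
  | Var x => rfl
  | Abs M ih =>
    simp only [urename, ubind, ih]
    congr 2
    funext x
    cases x <;> rfl
  | App M N ihM ihN => simp only [urename, ubind, ihM, ihN]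

theorem urename_ubind {X Y Z : Type} (f : X → ULC Y) (g : Y → Z) (M : ULC X) :
    urename g (ubind f M) = ubind (fun x => urename g (f x)) M := by
  induction M generalizing Y Z with
  | Var x => rfl
  | Abs M ih =>
    simp only [urename, ubind, ih]
    congr 2
    funext x
    cases x with
    | none => rfl
    | some x => simp only [ulift', urename_urename, Option.map_some]
  | App M N ihM ihN => simp only [urename, ubind, ihM, ihN]

theorem ubind_var {X : Type} (M : ULC X) : ubind ULC.Var M = M := by
  induction M with
  | Var x => rfl
  | Abs M ih =>
    simp only [ubind]
    conv_rhs => rw [← ih]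
    congr 2
    funext x
    cases x <;> rfl
  | App M N ihM ihN => simp only [ubind, ihM, ihN]

/-- The substitution of `N` for the fresh variable. -/
def sub1 {X : Type} (N : ULC X) : Option X → ULC X
  | none => N
  | some y => .Var y

theorem usubst1_eq {X : Type} (M : ULC (Option X)) (N : ULC X) :
    usubst1 M N = ubind (sub1 N) M := by
  unfold usubst1
  congr 1

theorem ubind_ulift_weaken {X Y : Type} (f : X → ULC Y) (P : ULC X) :
    ubind (ulift' f) (urename some P) = urename some (ubind f P) := by
  rw [ubind_urename, urename_ubind]
  rfl

theorem ubind_sub1_weaken {X : Type} (N P : ULC X) :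
    ubind (sub1 N) (urename some P) = P := by
  rw [ubind_urename]
  exact ubind_var P

/-! Closed terms: Scott numerals, Church booleans, Turing's fixed point combinator. -/

def tru {X : Type} : ULC X := .Abs (.Abs (.Var (some none)))
def fls {X : Type} : ULC X := .Abs (.Abs (.Var none))
def idt {X : Type} : ULC X := .Abs (.Var none)
def num : ∀ {X : Type}, ℕ → ULC X
  | _, 0 => .Abs (.Abs (.Var (some none)))
  | _, n + 1 => .Abs (.Abs (.App (.Var none) (num n)))
def suc {X : Type} : ULC X :=
  .Abs (.Abs (.Abs (.App (.Var none) (.Var (some (some none))))))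
def prd {X : Type} : ULC X := .Abs (.App (.App (.Var none) (num 0)) idt)
def isz {X : Type} : ULC X := .Abs (.App (.App (.Var none) tru) (.Abs fls))
def cnd {X : Type} : ULC X :=
  .Abs (.Abs (.Abs (.App (.App (.Var (some (some none))) (.Var (some none))) (.Var none))))
def tur {X : Type} : ULC X :=
  .Abs (.Abs (.App (.Var none)
    (.App (.App (.Var (some none)) (.Var (some none))) (.Var none))))
def fixc {X : Type} : ULC X := .App tur tur

theorem urename_num {X Y : Type} (f : X → Y) (n : ℕ) : urename f (num n) = num n := by
  induction n generalizing X Y with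
  | zero => rfl
  | succ n ih => simp only [num, urename, ih, Option.map_none]

theorem ubind_num {X Y : Type} (f : X → ULC Y) (n : ℕ) : ubind f (num n) = num n := by
  induction n generalizing X Y with
  | zero => rfl
  | succ n ih => simp only [num, ubind, ih, ulift']

/-- Collapse of the extended context. -/
def collapse {V : PTy → Type} {s : PTy} : (Σ t, ext V s t) → Option (Σ t, V t)
  | ⟨t, .inl v⟩ => some ⟨t, v⟩
  | ⟨_, .inr _⟩ => none

/-- The translation. -/
def tr : ∀ {V : PTy → Type} {t : PTy}, PCF V t → ULC (Σ t, V t)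
  | _, _, .Var t x => .Var ⟨t, x⟩
  | _, _, .Abs _ _ M => .Abs (urename collapse (tr M))
  | _, _, .App _ _ M N => .App (tr M) (tr N)
  | _, _, .Fix _ M => .App fixc (tr M)
  | _, _, .Num n => num n
  | _, _, .Succ => suc
  | _, _, .Pred => prd
  | _, _, .IsZero => isz
  | _, _, .True => tru
  | _, _, .False => fls
  | _, _, .CondNat => cnd
  | _, _, .CondBool => cnd

theorem tr_rename {V W : PTy → Type} (f : ∀ t, V t → W t) (t : PTy) (M : PCF V t) :
    tr (rename f t M) = urename (fun p => ⟨p.1, f p.1 p.2⟩) (tr M) := by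
  induction M generalizing W with
  | Var t x => rfl
  | Abs s t M ih =>
    simp only [rename, tr, urename, ih, urename_urename]
    congr 2
    funext p
    rcases p with ⟨u, v | h⟩ <;> rfl
  | App s t M N ihM ihN => simp only [rename, tr, urename, ihM, ihN]
  | Fix s M ih =>
    simp only [rename, tr, urename, ih]
    rfl
  | Num n => simp only [rename, tr, urename_num]
  | _ => rfl

theorem tr_bind {V W : PTy → Type} (f : ∀ t, V t → PCF W t) (t : PTy) (M : PCF V t) :
    tr (bind f t M) = ubind (fun p : Σ t, V t => tr (f p.1 p.2)) (tr M) := by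
  induction M generalizing W with
  | Var t x => rfl
  | Abs s t M ih =>
    simp only [_root_.bind, tr, ubind, ih, urename_ubind, ubind_urename]
    congr 2
    funext p
    rcases p with ⟨u, v | h⟩
    · simp only [lift, collapse, ulift']
      exact (congrArg (urename collapse)
        (tr_rename (W := ext W s) (fun _ w => Sum.inl w) u (f u v))).trans
        (urename_urename _ _ _)
    · rfl
  | App s t M N ihM ihN => simp only [_root_.bind, tr, ubind, ihM, ihN]
  | Fix s M ih =>
    simp only [_root_.bind, tr, ubind, ih]
    rfl
  | Num n => simp only [_root_.bind, tr, ubind_num]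
  | _ => rfl

section star
variable {X : Type}

theorem star_abs {M M' : ULC (Option X)} (h : UBetaStar M M') :
    UBetaStar (.Abs M) (.Abs M') :=
  Relation.ReflTransGen.lift ULC.Abs (fun _ _ h => UBeta.absCong h) _ _ h

theorem star_appL {M M' N : ULC X} (h : UBetaStar M M') :
    UBetaStar (.App M N) (.App M' N) :=
  Relation.ReflTransGen.lift (fun M => ULC.App M N) (fun _ _ h => UBeta.appL h) _ _ h

theorem star_appR {M N N' : ULC X} (h : UBetaStar N N') :
    UBetaStar (.App M N) (.App M N') :=
  Relation.ReflTransGen.lift (fun N => ULC.App M N) (fun _ _ h => UBeta.appR h) _ _ h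

theorem star_trans {M N P : ULC X} (h : UBetaStar M N) (h' : UBetaStar N P) :
    UBetaStar M P := Relation.ReflTransGen.trans h h'

theorem star_beta {M : ULC (Option X)} {N P : ULC X} (h : ubind (sub1 N) M = P) :
    UBetaStar (.App (.Abs M) N) P := by
  rw [← h, ← usubst1_eq]
  exact Relation.ReflTransGen.single (UBeta.beta M N)

theorem tru_red (M N : ULC X) : UBetaStar (.App (.App tru M) N) M :=
  star_trans (star_appL (star_beta (P := .Abs (urename some M)) rfl))
    (star_beta (ubind_sub1_weaken N M))

theorem fls_red (M N : ULC X) : UBetaStar (.App (.App fls M) N) N :=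
  star_trans (star_appL (star_beta (P := idt) rfl)) (star_beta rfl)

theorem suc_red (n : ℕ) : UBetaStar (.App suc (num n)) (num (n + 1) : ULC X) := by
  apply star_beta
  simp only [ubind, ulift', sub1, urename_num, num]

theorem num_succ_red (n : ℕ) (M N : ULC X) :
    UBetaStar (.App (.App (num (n + 1)) M) N) (.App N (num n)) := by
  refine star_trans (star_appL (star_beta (P := .Abs (.App (.Var none) (num n))) ?_))
    (star_beta ?_)
  · simp only [ubind, ulift', ubind_num]
  · simp only [ubind, sub1, ubind_num]

theorem prd_red (M : ULC X) :
    UBetaStar (.App prd M) (.App (.App M (num 0)) idt) := star_beta rfl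

theorem isz_red (M : ULC X) :
    UBetaStar (.App isz M) (.App (.App M tru) (.Abs fls)) := star_beta rfl

theorem cnd_red (B M N : ULC X) :
    UBetaStar (.App (.App (.App cnd B) M) N) (.App (.App B M) N) := by
  refine star_trans (star_appL (star_appL (star_beta rfl))) ?_
  refine star_trans (star_appL (star_beta rfl)) (star_beta ?_)
  simp only [ubind, ulift', sub1, urename, ubind_ulift_weaken, ubind_sub1_weaken]

theorem fix_red (M : ULC X) :
    UBetaStar (.App fixc M) (.App M (.App fixc M)) := by
  refine star_trans (star_appL (star_beta
    (P := .Abs (.App (.Var none) (.App (.App tur tur) (.Var none)))) rfl)) (star_beta rfl)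

end star

theorem beta_urename {X Y : Type} (f : X → Y) {M N : ULC X} (h : UBeta M N) :
    UBeta (urename f M) (urename f N) := by
  induction h generalizing Y with
  | beta M N =>
    have e : urename f (usubst1 M N) = usubst1 (urename (Option.map f) M) (urename f N) := by
      rw [usubst1_eq, usubst1_eq, urename_ubind, ubind_urename]
      congr 1
      funext x
      cases x <;> rfl
    rw [e]
    exact UBeta.beta _ _
  | absCong _ ih => exact UBeta.absCong (ih _)
  | appL _ ih => exact UBeta.appL (ih _)
  | appR _ ih => exact UBeta.appR (ih _)

theorem star_urename {X Y : Type} (f : X → Y) {M N : ULC X} (h : UBetaStar M N) :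
    UBetaStar (urename f M) (urename f N) :=
  Relation.ReflTransGen.lift (urename f) (fun _ _ h => beta_urename f h) _ _ h

theorem tr_red {V : PTy → Type} {t : PTy} {M N : PCF V t} (h : Red M N) :
    UBetaStar (tr M) (tr N) := by
  induction h with
  | beta M N =>
    apply star_beta
    rw [ubind_urename, subst1, tr_bind]
    congr 1
    funext p
    rcases p with ⟨u, v | hh⟩
    · rfl
    · obtain ⟨e⟩ := hh
      subst e
      rfl
  | fix M => exact fix_red _
  | predZero => exact star_trans (prd_red _) (tru_red _ _)
  | predSucc n =>
    exact star_trans (star_appR (suc_red n)) (star_trans (prd_red _)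
      (star_trans (num_succ_red n _ _) (star_beta rfl)))
  | iszeroZero => exact star_trans (isz_red _) (tru_red _ _)
  | iszeroSucc n =>
    exact star_trans (star_appR (suc_red n)) (star_trans (isz_red _)
      (star_trans (num_succ_red n _ _) (star_beta rfl)))
  | condNatTrue M N => exact star_trans (cnd_red _ _ _) (tru_red _ _)
  | condNatFalse M N => exact star_trans (cnd_red _ _ _) (fls_red _ _)
  | condBoolTrue M N => exact star_trans (cnd_red _ _ _) (tru_red _ _)
  | condBoolFalse M N => exact star_trans (cnd_red _ _ _) (fls_red _ _)
  | absCong _ ih =>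
    exact star_abs (star_urename _ ih)
  | appL _ ih => exact star_appL ih
  | appR _ ih => exact star_appR ih
  | fixCong _ ih => exact star_appR ih

end Trans

/-- There is a translation from PCF to the untyped lambda calculus which maps
variables to variables, commutes with simultaneous substitution, and is
faithful with respect to reduction. -/
theorem pcf_to_ulc_translation :
    ∃ θ : ∀ (V : PTy → Type) (t : PTy), PCF V t → ULC (Σ t : PTy, V t),
      (∀ (V : PTy → Type) (t : PTy) (x : V t),
          θ V t (PCF.Var t x) = ULC.Var ⟨t, x⟩) ∧
      (∀ (V W : PTy → Type) (f : ∀ t, V t → PCF W t) (t : PTy) (M : PCF V t),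
          θ W t (bind f t M) =
            ubind (fun p : Σ t : PTy, V t => θ W p.1 (f p.1 p.2)) (θ V t M)) ∧
      (∀ (V : PTy → Type) (t : PTy) (M N : PCF V t),
          RedStar M N → UBetaStar (θ V t M) (θ V t N)) := by
  refine ⟨fun V t M => Trans.tr M, fun V t x => rfl,
    fun V W f t M => Trans.tr_bind f t M, fun V t M N h => ?_⟩
  induction h with
  | refl => exact Relation.ReflTransGen.refl
  | tail _ h ih => exact Trans.star_trans ih (Trans.tr_red h)
end
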